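/- arXiv:1908.05708 — 6 statements merged into one kernel-verified Lean document; each statement's English description precedes it below -/
import Mathlib

section
/- Let 0 < α < β be real numbers and let z ∈ ℂ with z ≠ 0. The quartic polynomial P(ξ) = z²ξ⁴ − z(α²+β²)ξ² + (α²−β²)ξ + α²β² in ℂ[ξ] has a root of multiplicity at least two (i.e., there exists ξ₀ ∈ ℂ with P(ξ₀) = 0 and P′(ξ₀) = 0) if and only if D₁(z) = 0, where D₁(z) = −27(α²−β²)² + 4z(α²+β²)(α⁴−34α²β²+β⁴) + 16z²·α²β²(α²−β²)². -/
/-- A depressed quartic with vanishing discriminant and `p ≠ 0` has a multiple root. -/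
theorem depressed_aux (p q r : ℂ) (hp : p ≠ 0)
    (h : 16*p^4*r - 4*p^3*q^2 - 128*p^2*r^2 + 144*p*q^2*r - 27*q^4 + 256*r^3 = 0) :
    ∃ x : ℂ, x^4 + p*x^2 + q*x + r = 0 ∧ 4*x^3 + 2*p*x + q = 0 := by
  have key : ∃ x : ℂ, 2*p*x^2 + 3*q*x + 4*r = 0 ∧
      (2*p^3 - 8*p*r + 9*q^2)*x + (12*q*r + p^2*q) = 0 := by
    have hres : 2*p*(12*q*r + p^2*q)^2
        - 3*q*(2*p^3 - 8*p*r + 9*q^2)*(12*q*r + p^2*q)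
        + 4*r*(2*p^3 - 8*p*r + 9*q^2)^2 = 0 := by
      linear_combination p^2 * h
    by_cases hA : 2*p^3 - 8*p*r + 9*q^2 = 0
    · rw [hA] at hres
      have hB : 12*q*r + p^2*q = 0 := by
        have : 2*p*(12*q*r + p^2*q)^2 = 0 := by linear_combination hres
        simpa [hp] using this
      obtain ⟨w, hw⟩ := IsAlgClosed.exists_pow_nat_eq (9*q^2 - 32*p*r) (n := 2) (by norm_num)
      refine ⟨(w - 3*q)/(4*p), ?_, ?_⟩
      · field_simp
        linear_combination 2 * hw
      · rw [hA, hB]; ring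
    · generalize 2*p^3 - 8*p*r + 9*q^2 = A at *
      generalize 12*q*r + p^2*q = B at *
      refine ⟨-B/A, ?_, ?_⟩
      · field_simp
        linear_combination hres
      · field_simp
        ring
  obtain ⟨x, hG, hL⟩ := key
  have h2 : 4*x^3 + 2*p*x + q = 0 := by
    have : p^2*(4*x^3 + 2*p*x + q) = 0 := by
      linear_combination hL + (2*p*x - 3*q)*hG
    simpa [hp] using this
  refine ⟨x, ?_, h2⟩
  linear_combination (1/4)*hG + (x/4)*h2

/-- The quartic `P(ξ) = z²ξ⁴ − z(α²+β²)ξ² + (α²−β²)ξ + α²β²` (the spectral curve with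
denominators cleared) has a root of multiplicity at least two, i.e. a common zero of `P`
and `P′`, if and only if `D₁(z) = 0`. -/
theorem spectral_curve_multiple_root_iff (α β : ℝ) (hα : 0 < α) (hαβ : α < β)
    (z : ℂ) (hz : z ≠ 0) :
    (∃ ξ : ℂ,
        z ^ 2 * ξ ^ 4 - z * ((α : ℂ) ^ 2 + (β : ℂ) ^ 2) * ξ ^ 2
          + ((α : ℂ) ^ 2 - (β : ℂ) ^ 2) * ξ + (α : ℂ) ^ 2 * (β : ℂ) ^ 2 = 0 ∧
        4 * z ^ 2 * ξ ^ 3 - 2 * z * ((α : ℂ) ^ 2 + (β : ℂ) ^ 2) * ξ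
          + ((α : ℂ) ^ 2 - (β : ℂ) ^ 2) = 0) ↔
    -27 * ((α : ℂ) ^ 2 - (β : ℂ) ^ 2) ^ 2
      + 4 * z * ((α : ℂ) ^ 2 + (β : ℂ) ^ 2)
          * ((α : ℂ) ^ 4 - 34 * (α : ℂ) ^ 2 * (β : ℂ) ^ 2 + (β : ℂ) ^ 4)
      + 16 * z ^ 2 * (α : ℂ) ^ 2 * (β : ℂ) ^ 2 * ((α : ℂ) ^ 2 - (β : ℂ) ^ 2) ^ 2 = 0 := by
  have hd : (α : ℂ) ^ 2 - (β : ℂ) ^ 2 ≠ 0 := by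
    have : α ^ 2 - β ^ 2 ≠ 0 := by nlinarith
    exact_mod_cast this
  have hs : (α : ℂ) ^ 2 + (β : ℂ) ^ 2 ≠ 0 := by
    have : α ^ 2 + β ^ 2 ≠ 0 := by positivity
    exact_mod_cast this
  have hrel : ((α : ℂ) ^ 2 + (β : ℂ) ^ 2)^2 - 4*((α : ℂ) ^ 2 * (β : ℂ) ^ 2)
      = ((α : ℂ) ^ 2 - (β : ℂ) ^ 2)^2 := by ring
  have hD : -27 * ((α : ℂ) ^ 2 - (β : ℂ) ^ 2) ^ 2
      + 4 * z * ((α : ℂ) ^ 2 + (β : ℂ) ^ 2)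
          * ((α : ℂ) ^ 4 - 34 * (α : ℂ) ^ 2 * (β : ℂ) ^ 2 + (β : ℂ) ^ 4)
      + 16 * z ^ 2 * (α : ℂ) ^ 2 * (β : ℂ) ^ 2 * ((α : ℂ) ^ 2 - (β : ℂ) ^ 2) ^ 2
      = -27 * ((α : ℂ) ^ 2 - (β : ℂ) ^ 2) ^ 2
      + 4 * z * ((α : ℂ) ^ 2 + (β : ℂ) ^ 2)
          * (((α : ℂ) ^ 2 + (β : ℂ) ^ 2)^2 - 36 * ((α : ℂ) ^ 2 * (β : ℂ) ^ 2))
      + 16 * z ^ 2 * ((α : ℂ) ^ 2 * (β : ℂ) ^ 2) * ((α : ℂ) ^ 2 - (β : ℂ) ^ 2) ^ 2 := by ring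
  rw [hD]
  clear hD
  generalize (α : ℂ) ^ 2 - (β : ℂ) ^ 2 = d at *
  generalize (α : ℂ) ^ 2 + (β : ℂ) ^ 2 = s at *
  generalize (α : ℂ) ^ 2 * (β : ℂ) ^ 2 = m at *
  have hdisc : d^2 * (-27*d^2 + 4*z*s*(s^2 - 36*m) + 16*z^2*m*d^2)
      = 16*m*z^2*(s^2 - 4*m)^2 + 4*z*d^2*s*(s^2 - 36*m) - 27*d^4 := by
    rw [hrel]; ring
  constructor
  · rintro ⟨x, h1, h2⟩
    have e1 : d = 2*z*s*x - 4*z^2*x^3 := by linear_combination h2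
    have e2 : m = 3*z^2*x^4 - z*s*x^2 := by linear_combination h1 - x*h2
    have : d^2 * (-27*d^2 + 4*z*s*(s^2 - 36*m) + 16*z^2*m*d^2) = 0 := by
      rw [hdisc, e2, e1]; ring
    exact (mul_eq_zero.mp this).resolve_left (pow_ne_zero 2 hd)
  · intro h
    rw [h] at hdisc
    obtain ⟨y, h1, h2⟩ := depressed_aux (-(z*s)) (d*z) (m*z^2)
      (neg_ne_zero.mpr (mul_ne_zero hz hs)) (by linear_combination (-z^4) * hdisc)
    refine ⟨y/z, ?_, ?_⟩
    · field_simp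
      linear_combination h1
    · field_simp
      linear_combination h2
end

section
/- Let E be a complex Banach space, let ε > 0 and δ ≥ 0, let A ∈ E, and let f : ℂ → E be complex-differentiable on an open set containing the closed disk {|t| ≤ 2ε} with ‖f(t) − A‖ ≤ δ for all t with |t| = 2ε. Then for all z, w in the closed disk {|ζ| ≤ ε}, one has ‖f(z) − f(w)‖ ≤ (2δ/ε)·|z − w|. -/
/-- Refined key estimate: if `f` is analytic on a neighborhood of the closed disk of radius
`2ε` and `‖f(t) − A‖ ≤ δ` on the circle `|t| = 2ε` for some constant `A`, then
`‖f(z) − f(w)‖ ≤ (2δ/ε)|z − w|` on the closed disk of radius `ε`. -/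
theorem refined_key_difference_estimate {E : Type*} [NormedAddCommGroup E] [NormedSpace ℂ E]
    [CompleteSpace E] (ε δ : ℝ) (hε : 0 < ε) (hδ : 0 ≤ δ) (A : E) (f : ℂ → E)
    (hf : ∃ U : Set ℂ, IsOpen U ∧ Metric.closedBall (0 : ℂ) (2 * ε) ⊆ U ∧
      DifferentiableOn ℂ f U)
    (hbound : ∀ t : ℂ, ‖t‖ = 2 * ε → ‖f t - A‖ ≤ δ) :
    ∀ z ∈ Metric.closedBall (0 : ℂ) ε, ∀ w ∈ Metric.closedBall (0 : ℂ) ε,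
      ‖f z - f w‖ ≤ 2 * δ / ε * ‖z - w‖ := by
  obtain ⟨U, hU, hsub, hd⟩ := hf
  have hg : DifferentiableOn ℂ (fun t => f t - A) U := hd.sub_const A
  have hmax : ∀ t ∈ Metric.closedBall (0 : ℂ) (2 * ε), ‖f t - A‖ ≤ δ := by
    intro t ht
    have hne : (2 * ε) ≠ 0 := by positivity
    refine Complex.norm_le_of_forall_mem_frontier_norm_le (f := fun t => f t - A)
      (U := Metric.ball (0 : ℂ) (2 * ε)) Metric.isBounded_ball ?_ ?_ ?_
    · exact DifferentiableOn.diffContOnCl (hg.mono (Metric.closure_ball_subset_closedBall.trans hsub))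
    · intro s hs
      rw [frontier_ball _ hne] at hs
      exact hbound s (by simpa using hs)
    · rwa [closure_ball _ hne]
  have hderiv : ∀ x ∈ Metric.closedBall (0 : ℂ) ε, ‖deriv (fun t => f t - A) x‖ ≤ δ / ε := by
    intro x hx
    have hball : Metric.closedBall x ε ⊆ Metric.closedBall (0 : ℂ) (2 * ε) := by
      apply Metric.closedBall_subset_closedBall'
      have := Metric.mem_closedBall.1 hx
      linarith
    refine Complex.norm_deriv_le_of_forall_mem_sphere_norm_le hε ?_ ?_
    · exact DifferentiableOn.diffContOnCl
        (hg.mono (Metric.closure_ball_subset_closedBall.trans (hball.trans hsub)))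
    · intro s hs
      exact hmax s (hball (Metric.sphere_subset_closedBall hs))
  intro z hz w hw
  have hmv := Convex.norm_image_sub_le_of_norm_deriv_le (𝕜 := ℂ) (f := fun t => f t - A)
    (s := Metric.closedBall (0 : ℂ) ε) (C := δ / ε)
    (fun x hx => hg.differentiableAt (hU.mem_nhds (hsub
      (Metric.closedBall_subset_closedBall (by linarith) hx))))
    hderiv (convex_closedBall _ _) hw hz
  simp only [sub_sub_sub_cancel_right] at hmv
  refine hmv.trans (mul_le_mul_of_nonneg_right ?_ (norm_nonneg _))
  gcongr
  linarith
end

section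
/- Let c ≥ 0 and let μ be a finite Borel measure on ℝ with μ((−∞, −c]) = 0 (so μ is concentrated on (−c, ∞)). For x < −c define F(x) = √(−x)·(1/(π·√(−(x+c))))·∫ √(z+c)/(z − x) dμ(z). Then F is monotone nondecreasing on (−∞, −c). -/
open MeasureTheory

/-- For a finite measure `μ` concentrated on `(−c, ∞)`, the function
`x ↦ √|x| · (dμ̂_c/dx)(x)`, where `dμ̂_c/dx` is the density of the balayage of `μ` onto
`K_c = (−∞,−c]`, is nondecreasing on `(−∞,−c)`. -/
theorem sqrt_mul_balayage_density_monotone (c : ℝ) (hc : 0 ≤ c)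
    (μ : Measure ℝ) [IsFiniteMeasure μ] (hμ : μ (Set.Iic (-c)) = 0) :
    MonotoneOn
      (fun x => Real.sqrt (-x) * (1 / (Real.pi * Real.sqrt (-(x + c)))) *
        ∫ z, Real.sqrt (z + c) / (z - x) ∂μ)
      (Set.Iio (-c)) := by
  intro x hx y hy hxy
  simp only [Set.mem_Iio] at hx hy
  have hae : ∀ᵐ z ∂μ, -c < z := by
    rw [ae_iff]
    simpa [Set.Iic] using hμ
  have hint : Integrable (fun z => Real.sqrt (z + c) / (z - y)) μ := by
    refine Integrable.of_bound (C := 1 / Real.sqrt (-(y + c))) ?_ ?_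
    · exact Measurable.aestronglyMeasurable (by fun_prop)
    · filter_upwards [hae] with z hz
      have hd : 0 < Real.sqrt (-(y + c)) := Real.sqrt_pos.2 (by linarith)
      have h1 := Real.sq_sqrt (show 0 ≤ -(y + c) by linarith)
      have h2 := Real.sq_sqrt (show 0 ≤ z + c by linarith)
      rw [Real.norm_of_nonneg (div_nonneg (Real.sqrt_nonneg _) (by linarith)),
        div_le_div_iff₀ (by linarith) hd]
      nlinarith [sq_nonneg (Real.sqrt (-(y + c)) - Real.sqrt (z + c)),
        sq_nonneg (Real.sqrt (-(y + c))), sq_nonneg (Real.sqrt (z + c))]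
  have h0 : 0 ≤ᵐ[μ] fun z => Real.sqrt (z + c) / (z - x) := by
    filter_upwards [hae] with z hz
    exact div_nonneg (Real.sqrt_nonneg _) (by linarith)
  have hI : ∫ z, Real.sqrt (z + c) / (z - x) ∂μ ≤ ∫ z, Real.sqrt (z + c) / (z - y) ∂μ := by
    refine integral_mono_of_nonneg h0 hint ?_
    filter_upwards [hae] with z hz
    exact div_le_div_of_nonneg_left (Real.sqrt_nonneg _) (by linarith) (by linarith)
  have hF : Real.sqrt (-x) * (1 / (Real.pi * Real.sqrt (-(x + c)))) ≤
      Real.sqrt (-y) * (1 / (Real.pi * Real.sqrt (-(y + c)))) := by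
    have hdx : 0 < Real.sqrt (-(x + c)) := Real.sqrt_pos.2 (by linarith)
    have hdy : 0 < Real.sqrt (-(y + c)) := Real.sqrt_pos.2 (by linarith)
    have hp := Real.pi_pos
    rw [mul_one_div, mul_one_div, div_le_div_iff₀ (by positivity) (by positivity)]
    have h : Real.sqrt (-x) * Real.sqrt (-(y + c)) ≤ Real.sqrt (-y) * Real.sqrt (-(x + c)) := by
      rw [← Real.sqrt_mul (by linarith), ← Real.sqrt_mul (by linarith)]
      apply Real.sqrt_le_sqrt
      nlinarith
    nlinarith [mul_le_mul_of_nonneg_left h hp.le]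
  exact mul_le_mul hF hI (integral_nonneg_of_ae h0) (by positivity)
end

section
/- Let c ≥ 0 and α > 0, and let f : ℝ → ℝ be a nonnegative measurable function, integrable on (−∞, −c), such that x ↦ √(−x)·f(x) is monotone nondecreasing on (−∞, −c). Let S = {x ∈ (−∞, −c) : f(x) > α/(π·√(−x))}. Then there exists c̃ ≥ c such that (−c̃, −c) ⊆ S ⊆ [−c̃, −c). In particular, S is either empty or an interval with right endpoint −c. -/
open MeasureTheory

/-- If `f ≥ 0` is integrable on `(−∞,−c)` and `√(−x)·f(x)` is nondecreasing there, then the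
set where `f` exceeds the constraint density `α/(π√(−x))` is (up to its left endpoint) an
interval `(−c̃, −c)`: there is `c̃ ≥ c` with `(−c̃,−c) ⊆ S ⊆ [−c̃,−c)`. -/
theorem saturation_region_is_interval (c α : ℝ) (hc : 0 ≤ c) (hα : 0 < α)
    (f : ℝ → ℝ) (hnn : ∀ x, 0 ≤ f x) (hmeas : Measurable f)
    (hint : IntegrableOn f (Set.Iio (-c)))
    (hmono : MonotoneOn (fun x => Real.sqrt (-x) * f x) (Set.Iio (-c))) :
    ∃ ctil : ℝ, c ≤ ctil ∧
      Set.Ioo (-ctil) (-c) ⊆ {x : ℝ | x < -c ∧ α / (Real.pi * Real.sqrt (-x)) < f x} ∧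
      {x : ℝ | x < -c ∧ α / (Real.pi * Real.sqrt (-x)) < f x} ⊆ Set.Ico (-ctil) (-c) := by
  have key : ∀ x, x < -c → (α / (Real.pi * Real.sqrt (-x)) < f x ↔
      α / Real.pi < Real.sqrt (-x) * f x) := by
    intro x hx
    have hs : 0 < Real.sqrt (-x) := Real.sqrt_pos.mpr (by linarith)
    rw [← div_div, div_lt_iff₀ hs, mul_comm]
  set S : Set ℝ := {x : ℝ | x < -c ∧ α / (Real.pi * Real.sqrt (-x)) < f x} with hS
  have up : ∀ x ∈ S, ∀ y, x ≤ y → y < -c → y ∈ S := by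
    intro x hx y hxy hy
    refine ⟨hy, (key y hy).2 ?_⟩
    exact lt_of_lt_of_le ((key x hx.1).1 hx.2) (hmono hx.1 hy hxy)
  rcases S.eq_empty_or_nonempty with he | hne
  · refine ⟨c, le_rfl, ?_, ?_⟩
    · simp
    · rw [he]; exact Set.empty_subset _
  have hbdd : BddBelow S := by
    by_contra hb
    have hall : ∀ y, y < -c → y ∈ S := by
      intro y hy
      rw [not_bddBelow_iff] at hb
      obtain ⟨x, hx, hxy⟩ := hb y
      exact up x hx y hxy.le hy
    have h1 : IntegrableOn (fun x => f (-x)) (Set.Ioi c) := by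
      have h := hint.comp_neg
      simpa using h
    have h2 : IntegrableOn (fun x => f (-x)) (Set.Ioi (max c 1)) :=
      h1.mono_set (Set.Ioi_subset_Ioi (le_max_left _ _))
    have h3 : IntegrableOn (fun x : ℝ => (Real.pi / α) * f (-x)) (Set.Ioi (max c 1)) :=
      h2.const_mul _
    refine not_integrableOn_Ioi_inv (a := max c 1) ?_
    refine Integrable.mono' h3 measurable_inv.aestronglyMeasurable ?_
    filter_upwards [ae_restrict_mem measurableSet_Ioi] with x hx
    have hxc : c < x := lt_of_le_of_lt (le_max_left _ _) hx
    have hx1 : 1 < x := lt_of_le_of_lt (le_max_right _ _) hx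
    have hlt := (key (-x) (by linarith)).1 (hall (-x) (by linarith)).2
    rw [neg_neg] at hlt
    have hsq : Real.sqrt x ≤ x := by
      rw [Real.sqrt_le_left (by linarith)]
      nlinarith
    have hle : α / Real.pi < x * f (-x) :=
      lt_of_lt_of_le hlt (mul_le_mul_of_nonneg_right hsq (hnn _))
    rw [Real.norm_of_nonneg (by positivity), inv_le_iff_one_le_mul₀ (by linarith)]
    have hpi := Real.pi_pos
    rw [div_lt_iff₀ hpi] at hle
    rw [div_mul_eq_mul_div, div_mul_eq_mul_div, le_div_iff₀ hα]
    linarith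
  obtain ⟨z, hz⟩ := hne
  refine ⟨-sInf S, ?_, ?_, ?_⟩
  · have := csInf_le hbdd hz
    have := hz.1
    linarith
  · intro y hy
    rw [neg_neg] at hy
    obtain ⟨x, hx, hxy⟩ := exists_lt_of_csInf_lt ⟨z, hz⟩ hy.1
    exact up x hx y hxy.le hy.2
  · intro y hy
    rw [neg_neg]
    exact ⟨csInf_le hbdd hy, hy.1⟩
end

section
/- Let ω = e^{2πi/3} and let Û be the 3×3 complex matrix with rows (ω⁻¹, ω, 1), (−1, −1, −1), (ω, ω⁻¹, 1). For z ∈ ℂ \ (−∞, 0] let z^{1/3} denote the principal branch of the cube root (with branch cut along the negative real axis), and define E(z) = diag(z^{−1/3}, 1, z^{1/3}) · Û · diag(e^{−3ω z^{1/3}}, e^{−3ω⁻¹ z^{1/3}}, e^{−3 z^{1/3}}) · Û⁻¹ · diag(z^{1/3}, 1, z^{−1/3}). Then E extends to an entire function: there exists an entire matrix-valued function Q₁ : ℂ → M₃(ℂ) with Q₁(z) = E(z) for all z ∈ ℂ \ (−∞, 0]. -/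
def auxA (z : ℂ) : Matrix (Fin 3) (Fin 3) ℂ := !![0, 3, 0; 0, 0, 3; -3 * z, 0, 0]

section
attribute [local instance] Matrix.linftyOpNormedRing Matrix.linftyOpNormedAlgebra

theorem auxA_exp_diff (i j : Fin 3) :
    Differentiable ℂ fun z => (NormedSpace.exp (auxA z)) i j := by
  have h1 : Differentiable ℂ auxA := by
    have : auxA = fun z : ℂ => !![0, 3, 0; 0, 0, 3; 0, 0, 0] +
        z • (!![0, 0, 0; 0, 0, 0; -3, 0, 0] : Matrix (Fin 3) (Fin 3) ℂ) := by
      funext z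
      ext i j
      fin_cases i <;> fin_cases j <;> simp [auxA, mul_comm]
    rw [this]
    fun_prop
  have h2 : Differentiable ℂ
      (NormedSpace.exp : Matrix (Fin 3) (Fin 3) ℂ → Matrix (Fin 3) (Fin 3) ℂ) :=
    fun x => (NormedSpace.exp_analytic (𝕂 := ℂ) x).differentiableAt
  have h3 := h2.comp h1
  let L : Matrix (Fin 3) (Fin 3) ℂ →L[ℂ] ℂ :=
    LinearMap.toContinuousLinearMap (Matrix.entryLinearMap ℂ ℂ i j)
  exact L.differentiable.comp h3
end

/-- The matrix-valued function
`Q₁(z) = z^{−B/3}·Û·diag(e^{−3ωz^{1/3}}, e^{−3ω⁻¹z^{1/3}}, e^{−3z^{1/3}})·Û⁻¹·z^{B/3}`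
(with `B = diag(1,0,−1)` and principal branches off `(−∞,0]`) extends to an entire function. -/
theorem entire_factor_Q1 (ω : ℂ) (hω : ω = Complex.exp (2 * Real.pi * Complex.I / 3))
    (U : Matrix (Fin 3) (Fin 3) ℂ)
    (hU : U = !![ω⁻¹, ω, 1; -1, -1, -1; ω, ω⁻¹, 1]) :
    ∃ Q₁ : ℂ → Matrix (Fin 3) (Fin 3) ℂ,
      (∀ i j, Differentiable ℂ fun z => Q₁ z i j) ∧
      ∀ z : ℂ, ¬(z.im = 0 ∧ z.re ≤ 0) →
        Q₁ z = Matrix.diagonal ![z ^ (-(1 / 3) : ℂ), 1, z ^ ((1 / 3) : ℂ)] * U *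
          Matrix.diagonal ![Complex.exp (-3 * ω * z ^ ((1 / 3) : ℂ)),
            Complex.exp (-3 * ω⁻¹ * z ^ ((1 / 3) : ℂ)),
            Complex.exp (-3 * z ^ ((1 / 3) : ℂ))] * U⁻¹ *
          Matrix.diagonal ![z ^ ((1 / 3) : ℂ), 1, z ^ (-(1 / 3) : ℂ)] := by
  have hω3 : ω ^ 3 = 1 := by
    rw [hω, ← Complex.exp_nat_mul, ← Complex.exp_two_pi_mul_I]
    congr 1
    push_cast
    ring
  have hω0 : ω ≠ 0 := by rw [hω]; exact Complex.exp_ne_zero _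
  have hω1 : ω ≠ 1 := by
    have hp : IsPrimitiveRoot ω 3 := by
      have := Complex.isPrimitiveRoot_exp 3 (by norm_num)
      rw [hω]
      exact_mod_cast this
    exact hp.ne_one (by norm_num)
  have hs : ω ^ 2 + ω + 1 = 0 := by
    have : (ω - 1) * (ω ^ 2 + ω + 1) = 0 := by linear_combination hω3
    exact (mul_eq_zero.mp this).resolve_left (sub_ne_zero.mpr hω1)
  have hinv : ω⁻¹ = ω ^ 2 := by
    field_simp
    exact hω3.symm
  rw [hinv] at hU ⊢
  have hUV : U * ((1 / 3 : ℂ) • !![ω, -1, ω ^ 2; ω ^ 2, -1, ω; 1, -1, 1]) = 1 := by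
    rw [hU]
    ext i j
    fin_cases i <;> fin_cases j <;> simp [Matrix.mul_apply, Fin.sum_univ_three] <;> grind
  have hUdet : IsUnit U.det := by
    rw [← Matrix.isUnit_iff_isUnit_det]
    exact IsUnit.of_mul_eq_one _ hUV
  refine ⟨fun z => NormedSpace.exp (auxA z), auxA_exp_diff, ?_⟩
  intro z hz
  have hz0 : z ≠ 0 := by
    rintro rfl
    exact hz (by simp)
  rw [Complex.cpow_neg]
  have hs3 : (z ^ ((1 / 3) : ℂ)) ^ 3 = z := by
    rw [← Complex.cpow_nat_mul]
    norm_num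
  have hs0 : z ^ ((1 / 3) : ℂ) ≠ 0 := by
    intro h
    rw [h] at hs3
    exact hz0 (by rw [← hs3]; norm_num)
  generalize z ^ ((1 / 3) : ℂ) = s at hs3 hs0
  set d : Matrix (Fin 3) (Fin 3) ℂ := Matrix.diagonal ![s⁻¹, 1, s] with hd
  have hdd : d * Matrix.diagonal ![s, 1, s⁻¹] = 1 := by
    rw [hd, Matrix.diagonal_mul_diagonal, ← Matrix.diagonal_one]
    congr 1
    ext i
    fin_cases i <;> simp [hs0]
  have hdi : d⁻¹ = Matrix.diagonal ![s, 1, s⁻¹] := Matrix.inv_eq_right_inv hdd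
  have hdU : IsUnit d := IsUnit.of_mul_eq_one _ hdd
  have hPU : IsUnit (d * U) := hdU.mul ((Matrix.isUnit_iff_isUnit_det _).mpr hUdet)
  have hexp : Matrix.diagonal ![Complex.exp (-3 * ω * s), Complex.exp (-3 * ω ^ 2 * s),
      Complex.exp (-3 * s)]
      = NormedSpace.exp (Matrix.diagonal ![-3 * ω * s, -3 * ω ^ 2 * s, -3 * s]) := by
    rw [Matrix.exp_diagonal]
    congr 1
    ext i
    rw [Pi.coe_exp, ← Complex.exp_eq_exp_ℂ]
    fin_cases i <;> rfl
  rw [← hdi, hexp, Matrix.mul_assoc _ U⁻¹ d⁻¹, ← Matrix.mul_inv_rev, ← Matrix.exp_conj _ _ hPU]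
  show NormedSpace.exp (auxA z) = _
  congr 1
  have hPdet := (Matrix.isUnit_iff_isUnit_det _).mp hPU
  have key : d * U * Matrix.diagonal ![-3 * ω * s, -3 * ω ^ 2 * s, -3 * s]
      = auxA z * (d * U) := by
    rw [hd, hU, auxA]
    ext i j
    fin_cases i <;> fin_cases j <;>
      simp [Matrix.mul_apply, Fin.sum_univ_three, Matrix.diagonal, ← hs3] <;> field_simp <;> grind
  rw [key, Matrix.mul_nonsing_inv_cancel_right _ _ hPdet]
end

section
/- Let ω = e^{2πi/3}, let Û be the 3×3 complex matrix with rows (ω⁻¹, ω, 1), (−1, −1, −1), (ω, ω⁻¹, 1), let ρ > 0, and let ϑ be a complex-analytic function on the disk D(0, ρ) = {|z| < ρ}. For z ∈ D(0, ρ) \ (−∞, 0] let z^{1/3} and z^{2/3} denote principal branches (branch cut along the negative real axis), and define F(z) = diag(z^{−1/3}, 1, z^{1/3}) · Û · diag(e^{ω⁻¹ z^{2/3} ϑ(z)}, e^{ω z^{2/3} ϑ(z)}, e^{z^{2/3} ϑ(z)}) · Û⁻¹ · diag(z^{1/3}, 1, z^{−1/3}). Then F extends to an analytic function on all of D(0,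 ρ): there exists an analytic matrix-valued function Q₂ on D(0, ρ) with Q₂(z) = F(z) for all z ∈ D(0, ρ) \ (−∞, 0]. -/
/-- The entire function `∑ uⁿ/(3n+r)!`. -/
noncomputable def sectionExp (r : ℕ) (u : ℂ) : ℂ :=
  ∑' n : ℕ, u ^ n / ((r + 3 * n).factorial : ℂ)

theorem sectionExp_differentiable (r : ℕ) : Differentiable ℂ (sectionExp r) := by
  intro x
  have hd : DifferentiableOn ℂ (sectionExp r) (Metric.ball 0 (‖x‖ + 1)) := by
    unfold sectionExp
    refine Complex.differentiableOn_tsum_of_summable_norm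
      (u := fun n : ℕ => (‖x‖ + 1) ^ n / (n.factorial : ℝ))
      (Real.summable_pow_div_factorial _) ?_ Metric.isOpen_ball ?_
    · intro n
      fun_prop
    · intro n w hw
      have hw' : ‖w‖ ≤ ‖x‖ + 1 := by
        have := mem_ball_zero_iff.1 hw
        exact this.le
      rw [norm_div, norm_pow, Complex.norm_natCast]
      have h1 : (n.factorial : ℝ) ≤ ((r + 3 * n).factorial : ℝ) := by
        exact_mod_cast Nat.factorial_le (by omega)
      have h2 : (0 : ℝ) < n.factorial := by exact_mod_cast Nat.factorial_pos n
      gcongr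
  refine hd.differentiableAt (Metric.isOpen_ball.mem_nhds ?_)
  rw [mem_ball_zero_iff]
  linarith

theorem exp_eq_sections (x : ℂ) : Complex.exp x =
    sectionExp 0 (x ^ 3) + x * sectionExp 1 (x ^ 3) + x ^ 2 * sectionExp 2 (x ^ 3) := by
  have hs : Summable (fun n : ℕ => x ^ n / (n.factorial : ℂ)) :=
    NormedSpace.expSeries_div_summable x
  have h := Nat.sumByResidueClasses hs 3
  have he : Complex.exp x = ∑' n : ℕ, x ^ n / (n.factorial : ℂ) := by
    rw [Complex.exp_eq_exp_ℂ, NormedSpace.exp_eq_tsum_div]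
  have key : ∀ r : ℕ, ∑' m : ℕ, x ^ (r + 3 * m) / ((r + 3 * m).factorial : ℂ)
      = x ^ r * sectionExp r (x ^ 3) := by
    intro r
    unfold sectionExp
    rw [← tsum_mul_left]
    congr 1
    ext m
    rw [pow_add, pow_mul, mul_div_assoc]
  rw [he, h]
  have h3 : ∀ g : ZMod 3 → ℂ, ∑ j : ZMod 3, g j = g 0 + g 1 + g 2 := fun g =>
    Fin.sum_univ_three g
  rw [h3]
  have e0 : (0 : ZMod 3).val = 0 := rfl
  have e1 : (1 : ZMod 3).val = 1 := rfl
  have e2 : (2 : ZMod 3).val = 2 := rfl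
  rw [e0, e1, e2, key, key, key]
  ring

/-- For any `ϑ` analytic on the disk `D(0,ρ)`, the matrix-valued function
`Q₂(z) = z^{−B/3}·Û·diag(e^{ω⁻¹z^{2/3}ϑ(z)}, e^{ωz^{2/3}ϑ(z)}, e^{z^{2/3}ϑ(z)})·Û⁻¹·z^{B/3}`
(with `B = diag(1,0,−1)` and principal branches off `(−∞,0]`) extends analytically to the
whole disk `D(0,ρ)`. -/
theorem analytic_factor_Q2 (ω : ℂ) (hω : ω = Complex.exp (2 * Real.pi * Complex.I / 3))
    (U : Matrix (Fin 3) (Fin 3) ℂ)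
    (hU : U = !![ω⁻¹, ω, 1; -1, -1, -1; ω, ω⁻¹, 1])
    (ρ : ℝ) (hρ : 0 < ρ) (ϑ : ℂ → ℂ)
    (hϑ : DifferentiableOn ℂ ϑ (Metric.ball (0 : ℂ) ρ)) :
    ∃ Q₂ : ℂ → Matrix (Fin 3) (Fin 3) ℂ,
      (∀ i j, DifferentiableOn ℂ (fun z => Q₂ z i j) (Metric.ball (0 : ℂ) ρ)) ∧
      ∀ z ∈ Metric.ball (0 : ℂ) ρ, ¬(z.im = 0 ∧ z.re ≤ 0) →
        Q₂ z = Matrix.diagonal ![z ^ (-(1 / 3) : ℂ), 1, z ^ ((1 / 3) : ℂ)] * U *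
          Matrix.diagonal ![Complex.exp (ω⁻¹ * z ^ ((2 : ℂ) / 3) * ϑ z),
            Complex.exp (ω * z ^ ((2 : ℂ) / 3) * ϑ z),
            Complex.exp (z ^ ((2 : ℂ) / 3) * ϑ z)] * U⁻¹ *
          Matrix.diagonal ![z ^ ((1 / 3) : ℂ), 1, z ^ (-(1 / 3) : ℂ)] := by
  have hprim : IsPrimitiveRoot ω 3 := by
    rw [hω]
    exact Complex.isPrimitiveRoot_exp 3 (by norm_num)
  have hω3 : ω ^ 3 = 1 := hprim.pow_eq_one
  have hω1 : ω ≠ 1 := hprim.ne_one (by norm_num)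
  have hω2 : ω ^ 2 = -1 - ω := by
    have h0 : (ω - 1) * (ω ^ 2 + ω + 1) = 0 := by linear_combination hω3
    rcases mul_eq_zero.1 h0 with h | h
    · exact absurd (sub_eq_zero.1 h) hω1
    · linear_combination h
  have hinv : ω⁻¹ = -1 - ω := by
    have : ω * (-1 - ω) = 1 := by linear_combination -hω2
    exact inv_eq_of_mul_eq_one_right this
  clear hω hprim
  have hUinv : U⁻¹ = !![ω / 3, -1 / 3, (-1 - ω) / 3; (-1 - ω) / 3, -1 / 3, ω / 3;
      1 / 3, -1 / 3, 1 / 3] := by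
    apply Matrix.inv_eq_right_inv
    rw [hU, hinv]
    ext i j
    fin_cases i <;> fin_cases j <;> simp [Matrix.mul_apply, Fin.sum_univ_three] <;> grind
  have hG : ∀ r, DifferentiableOn ℂ (fun z => sectionExp r (z ^ 2 * ϑ z ^ 3))
      (Metric.ball (0 : ℂ) ρ) := by
    intro r
    exact (sectionExp_differentiable r).comp_differentiableOn
      ((differentiableOn_id.pow 2).mul (hϑ.pow 3))
  have hG0 := hG 0
  have hG1 := hG 1
  have hG2 := hG 2
  refine ⟨fun z =>
    !![sectionExp 0 (z ^ 2 * ϑ z ^ 3), -(z * (ϑ z ^ 2 * sectionExp 2 (z ^ 2 * ϑ z ^ 3))),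
        ϑ z * sectionExp 1 (z ^ 2 * ϑ z ^ 3);
      -(z * (ϑ z * sectionExp 1 (z ^ 2 * ϑ z ^ 3))), sectionExp 0 (z ^ 2 * ϑ z ^ 3),
        -(z * (ϑ z ^ 2 * sectionExp 2 (z ^ 2 * ϑ z ^ 3)));
      z ^ 2 * (ϑ z ^ 2 * sectionExp 2 (z ^ 2 * ϑ z ^ 3)),
        -(z * (ϑ z * sectionExp 1 (z ^ 2 * ϑ z ^ 3))), sectionExp 0 (z ^ 2 * ϑ z ^ 3)],
    ?_, ?_⟩
  · intro i j
    fin_cases i <;> fin_cases j <;> simp <;> fun_prop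
  · intro z _ hz
    have hz0 : z ≠ 0 := by
      rintro rfl
      exact hz (by simp)
    obtain ⟨s, hs⟩ : ∃ s, s = z ^ ((1 / 3) : ℂ) := ⟨_, rfl⟩
    have hs3 : s ^ 3 = z := by
      rw [hs, ← Complex.cpow_nat_mul]
      norm_num
    have hsn : z ^ (-(1 / 3) : ℂ) = s⁻¹ := by rw [Complex.cpow_neg, hs]
    have hs2 : z ^ ((2 : ℂ) / 3) = s ^ 2 := by
      rw [hs, ← Complex.cpow_nat_mul]
      norm_num
    have hs0 : s ≠ 0 := by
      rintro rfl
      apply hz0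
      rw [← hs3]
      norm_num
    rw [hsn, hs2, ← hs, hUinv, hU, hinv]
    clear hsn hs2 hs hUinv hU hinv
    have hinv3 : (-1 - ω) ^ 3 = 1 := by grind
    have c1 : ((-1 - ω) * s ^ 2 * ϑ z) ^ 3 = z ^ 2 * ϑ z ^ 3 := by
      rw [mul_pow, mul_pow, hinv3, ← hs3]; ring
    have c2 : (ω * s ^ 2 * ϑ z) ^ 3 = z ^ 2 * ϑ z ^ 3 := by
      rw [mul_pow, mul_pow, hω3, ← hs3]; ring
    have c3 : (s ^ 2 * ϑ z) ^ 3 = z ^ 2 * ϑ z ^ 3 := by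
      rw [mul_pow, ← hs3]; ring
    rw [exp_eq_sections ((-1 - ω) * s ^ 2 * ϑ z), exp_eq_sections (ω * s ^ 2 * ϑ z),
      exp_eq_sections (s ^ 2 * ϑ z), c1, c2, c3]
    beta_reduce
    generalize sectionExp 0 (z ^ 2 * ϑ z ^ 3) = a
    generalize sectionExp 1 (z ^ 2 * ϑ z ^ 3) = b
    generalize sectionExp 2 (z ^ 2 * ϑ z ^ 3) = c
    clear c1 c2 c3 hG hG0 hG1 hG2 hϑ
    generalize ϑ z = t
    obtain ⟨v, hv⟩ : ∃ v, v = s⁻¹ := ⟨_, rfl⟩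
    have hsv : s * v = 1 := by rw [hv]; exact mul_inv_cancel₀ hs0
    rw [← hv]
    clear hv
    subst hs3
    clear hz hz0 hinv3
    ext i j
    fin_cases i <;> fin_cases j <;>
      simp [Matrix.mul_apply, Fin.sum_univ_three, Matrix.diagonal_apply] <;> grind
end
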